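/- arXiv:2204.12051 — 3 statements merged into one kernel-verified Lean document; each statement's English description precedes it below -/
import Mathlib

section
/- Let n ≥ 2 and d ≥ 2. For every unitary U on (ℂ^d)^{⊗n}, the magic entropy and the circuit sensitivity satisfy M[U] ≤ 2·(log n + log d)·(CiS[U] + 1). -/
open Matrix Complex BigOperators
open scoped ComplexOrder
noncomputable section

namespace QC

/-- Operators on the `n`-qudit space `(ℂ^d)^{⊗n}`, as matrices indexed by
computational basis labels `Fin n → Fin d`. -/
abbrev QOp (d n : ℕ) := Matrix (Fin n → Fin d) (Fin n → Fin d) ℂ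

/-- The qudit shift operator `X`, with `X|j⟩ = |j+1 mod d⟩`. -/
def shiftX (d : ℕ) : Matrix (Fin d) (Fin d) ℂ :=
  fun i j => if (i : ℕ) = ((j : ℕ) + 1) % d then 1 else 0

/-- The qudit clock operator `Z`, with `Z|j⟩ = e^{2πij/d}|j⟩`. -/
def clockZ (d : ℕ) : Matrix (Fin d) (Fin d) ℂ :=
  Matrix.diagonal (fun j => Complex.exp (2 * Real.pi * Complex.I * (j : ℕ) / d))

/-- The single-qudit Pauli operator `P_a = X^s Z^t` for `a = (s,t) ∈ ℤ_d × ℤ_d`. -/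
def pauli1 (d : ℕ) (a : ZMod d × ZMod d) : Matrix (Fin d) (Fin d) ℂ :=
  shiftX d ^ a.1.val * clockZ d ^ a.2.val

/-- The `n`-qudit Pauli operator `P_ā = P_{a_1} ⊗ ⋯ ⊗ P_{a_n}`. -/
def pauliN (d n : ℕ) (a : Fin n → ZMod d × ZMod d) : QOp d n :=
  fun x y => ∏ i, pauli1 d (a i) (x i) (y i)

/-- The weight `|ā|`: the number of indices `i` with `a_i ≠ (0,0)`. -/
def weight (d n : ℕ) (a : Fin n → ZMod d × ZMod d) : ℕ :=
  (Finset.univ.filter (fun i => a i ≠ 0)).card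

/-- `P_O[ā] = |Tr(O P_ā)|² / d^{2n}`. -/
def pdist (d n : ℕ) (O : QOp d n) (a : Fin n → ZMod d × ZMod d) : ℝ :=
  ‖(O * pauliN d n a).trace‖ ^ 2 / (d : ℝ) ^ (2 * n)

/-- The normalized 2-norm `‖O‖₂ = (Tr(O†O)/d^n)^{1/2}`. -/
def l2norm (d n : ℕ) (O : QOp d n) : ℝ :=
  Real.sqrt (((Oᴴ * O).trace).re / (d : ℝ) ^ n)

/-- The total influence `I[O] = Σ_ā |ā|·P_O[ā]`. -/
def influence (d n : ℕ) [NeZero d] (O : QOp d n) : ℝ :=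
  ∑ a : Fin n → ZMod d × ZMod d, (weight d n a : ℝ) * pdist d n O a

/-- The local influence `I_j[O] = Σ_{ā : a_j ≠ 0} P_O[ā]`. -/
def localInfluence (d n : ℕ) [NeZero d] (j : Fin n) (O : QOp d n) : ℝ :=
  ∑ a ∈ Finset.univ.filter (fun a : Fin n → ZMod d × ZMod d => a j ≠ 0), pdist d n O a

/-- The quantum Fourier entropy `H[O] = -Σ_ā P_O[ā] log₂ P_O[ā]` (with `0·log 0 = 0`). -/
def qEntropy (d n : ℕ) [NeZero d] (O : QOp d n) : ℝ :=
  -∑ a : Fin n → ZMod d × ZMod d, pdist d n O a * Real.logb 2 (pdist d n O a)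

/-- The binary entropy `h(x) = -x log₂ x - (1-x) log₂ (1-x)`. -/
def binEntropy (x : ℝ) : ℝ :=
  -(x * Real.logb 2 x) - (1 - x) * Real.logb 2 (1 - x)

/-- Circuit sensitivity `CiS[U] = sup { |I[UOU†] - I[O]| : ‖O‖₂ = 1 }`. -/
def CiS (d n : ℕ) [NeZero d] (U : QOp d n) : ℝ :=
  sSup {x : ℝ | ∃ O : QOp d n, l2norm d n O = 1 ∧
    x = |influence d n (U * O * Uᴴ) - influence d n O|}

/-- Magic power `𝓜[U] = sup { |H[UOU†] - H[O]| : ‖O‖₂ = 1 }`. -/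
def magicPower (d n : ℕ) [NeZero d] (U : QOp d n) : ℝ :=
  sSup {x : ℝ | ∃ O : QOp d n, l2norm d n O = 1 ∧
    x = |qEntropy d n (U * O * Uᴴ) - qEntropy d n O|}

/-- Magic entropy `M[U] = max { H[U P_ā U†] : |ā| = 1 }`. -/
def magicEntropy (d n : ℕ) [NeZero d] (U : QOp d n) : ℝ :=
  sSup {x : ℝ | ∃ a : Fin n → ZMod d × ZMod d, weight d n a = 1 ∧
    x = qEntropy d n (U * pauliN d n a * Uᴴ)}

/-- The operator norm `‖A‖∞` (the L2 → L2 operator norm). -/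
def opNorm (d n : ℕ) (A : QOp d n) : ℝ :=
  ‖Matrix.toEuclideanCLM (𝕜 := ℂ) (n := Fin n → Fin d) A‖

/-- The influence rate `R_I(H,O)`. -/
def influenceRate (d n : ℕ) [NeZero d] (H O : QOp d n) : ℂ :=
  (Complex.I / (d : ℂ) ^ (2 * n)) * ∑ a : Fin n → ZMod d × ZMod d, (weight d n a : ℂ) *
    (((O * H - H * O) * pauliN d n a).trace * (O * (pauliN d n a)ᴴ).trace +
     ((O * H - H * O) * (pauliN d n a)ᴴ).trace * (O * pauliN d n a).trace)

/-- The magic rate `R_M(H,O)`. -/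
def magicRate (d n : ℕ) [NeZero d] (H O : QOp d n) : ℂ :=
  (Complex.I / (d : ℂ) ^ (2 * n)) * ∑ a : Fin n → ZMod d × ZMod d,
    (((O * H - H * O) * pauliN d n a).trace * (O * (pauliN d n a)ᴴ).trace +
     ((O * H - H * O) * (pauliN d n a)ᴴ).trace * (O * pauliN d n a).trace) *
    (Real.logb 2 (pdist d n O a) : ℂ)

/-- Extend an operator on the first `k` qudits by the identity: `H₀ ⊗ I`. -/
def extendOp (d k n : ℕ) (h : k ≤ n) (H0 : QOp d k) : QOp d n :=
  fun x y => if ∀ i : Fin n, k ≤ (i : ℕ) → x i = y i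
    then H0 (fun i => x (Fin.castLE h i)) (fun i => y (Fin.castLE h i)) else 0

/-- The tensor product `A ⊗ B` of an `n₁`-qudit and an `n₂`-qudit operator. -/
def tensorOp (d n₁ n₂ : ℕ) (A : QOp d n₁) (B : QOp d n₂) : QOp d (n₁ + n₂) :=
  fun x y => A (fun i => x (Fin.castAdd n₂ i)) (fun i => y (Fin.castAdd n₂ i)) *
             B (fun i => x (Fin.natAdd n₁ i)) (fun i => y (Fin.natAdd n₁ i))

/-- Embed a single-qudit operator `W` at position `j` (identity elsewhere). -/
def embedAt (d n : ℕ) (j : Fin n) (W : Matrix (Fin d) (Fin d) ℂ) : QOp d n :=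
  fun x y => if ∀ i, i ≠ j → x i = y i then W (x j) (y j) else 0

/-- The swap unitary exchanging qudits `i` and `j`. -/
def swapOp (d n : ℕ) (i j : Fin n) : QOp d n :=
  fun x y => if x = y ∘ Equiv.swap i j then 1 else 0

/-- The qubit Pauli X matrix. -/
def pauliX : Matrix (Fin 2) (Fin 2) ℂ := !![0, 1; 1, 0]

/-- The qubit Pauli Y matrix. -/
def pauliY : Matrix (Fin 2) (Fin 2) ℂ := !![0, -Complex.I; Complex.I, 0]

/-- The qubit Pauli Z matrix. -/
def pauliZ : Matrix (Fin 2) (Fin 2) ℂ := !![1, 0; 0, -1]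

/-- The ordered product `γ^S = ∏_{i∈S} γ_i` (factors in increasing index order). -/
def gammaProd (n : ℕ) (γ : Fin (2 * n) → QOp 2 n) (S : Finset (Fin (2 * n))) : QOp 2 n :=
  ((S.sort (· ≤ ·)).map γ).prod

/-- `P^G_O[S] = |Tr((γ^S)† O)|² / 2^{2n}`. -/
def pdistG (n : ℕ) (γ : Fin (2 * n) → QOp 2 n) (O : QOp 2 n) (S : Finset (Fin (2 * n))) : ℝ :=
  ‖((gammaProd n γ S)ᴴ * O).trace‖ ^ 2 / (2 : ℝ) ^ (2 * n)

/-- The Gaussian influence `I^G[O] = Σ_S |S|·P^G_O[S]`. -/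
def influenceG (n : ℕ) (γ : Fin (2 * n) → QOp 2 n) (O : QOp 2 n) : ℝ :=
  ∑ S : Finset (Fin (2 * n)), (S.card : ℝ) * pdistG n γ O S

/-- The Gaussian Fourier entropy `H^G[O] = -Σ_S P^G_O[S] log₂ P^G_O[S]`. -/
def entropyG (n : ℕ) (γ : Fin (2 * n) → QOp 2 n) (O : QOp 2 n) : ℝ :=
  -∑ S : Finset (Fin (2 * n)), pdistG n γ O S * Real.logb 2 (pdistG n γ O S)

/-- Gaussian circuit sensitivity `CiS^G[U] = sup { |I^G[UOU†] - I^G[O]| : ‖O‖₂ = 1 }`. -/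
def CiSG (n : ℕ) (γ : Fin (2 * n) → QOp 2 n) (U : QOp 2 n) : ℝ :=
  sSup {x : ℝ | ∃ O : QOp 2 n, l2norm 2 n O = 1 ∧
    x = |influenceG n γ (U * O * Uᴴ) - influenceG n γ O|}

/-- Fourier coefficient `f̂(S)` of a Boolean function `f : {-1,1}^n → ℝ`, with
the domain encoded as `Fin n → Bool` (`true ↦ -1`, `false ↦ 1`). -/
def fourierCoeff (n : ℕ) (f : (Fin n → Bool) → ℝ) (S : Finset (Fin n)) : ℝ :=
  (∑ x : Fin n → Bool, f x * ∏ i ∈ S, (if x i then -1 else 1)) / 2 ^ n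

/-- Fourier entropy of a Boolean function. -/
def boolEntropy (n : ℕ) (f : (Fin n → Bool) → ℝ) : ℝ :=
  -∑ S : Finset (Fin n), (fourierCoeff n f S) ^ 2 * Real.logb 2 ((fourierCoeff n f S) ^ 2)

/-- Total influence of a Boolean function. -/
def boolInfluence (n : ℕ) (f : (Fin n → Bool) → ℝ) : ℝ :=
  ∑ S : Finset (Fin n), (S.card : ℝ) * (fourierCoeff n f S) ^ 2

/-- The completely dephasing channel `Δ`. -/
def dephase (d n : ℕ) (A : QOp d n) : QOp d n :=
  Matrix.diagonal (fun i => A i i)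

/-- The diagonal matrix `log₂ Δ(ρ)` (entrywise base-2 logarithm of the diagonal). -/
def logDephase (d n : ℕ) (A : QOp d n) : QOp d n :=
  Matrix.diagonal (fun i => (Real.logb 2 (A i i).re : ℂ))

/-- The coherence rate `R_C(H,ρ) = -i Tr([ρ, log Δ(ρ)] H)`. -/
def cohRate (d n : ℕ) (H ρ : QOp d n) : ℂ :=
  -Complex.I * ((ρ * logDephase d n ρ - logDephase d n ρ * ρ) * H).trace

/-- The max-relative entropy `D_max(ρ‖σ) = log₂ min{λ > 0 : ρ ≤ λσ}`. -/
def Dmax (d n : ℕ) (ρ σ : QOp d n) : ℝ :=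
  Real.logb 2 (sInf {l : ℝ | 0 < l ∧ ((l : ℂ) • σ - ρ).PosSemidef})

/-- A sum over `ZMod d` of a function of the canonical representative. -/
theorem sum_zmod_val {M : Type*} [AddCommMonoid M] (d : ℕ) [NeZero d] (f : ℕ → M) :
    ∑ t : ZMod d, f t.val = ∑ i ∈ Finset.range d, f i := by
  obtain _ | m := d
  · exact absurd rfl (NeZero.ne 0)
  · exact Fin.sum_univ_eq_sum_range f (m + 1)

theorem sum_range_pow_of_pow_eq_one {d : ℕ} {ζ : ℂ} (h : ζ ^ d = 1) (h1 : ζ ≠ 1) :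
    ∑ i ∈ Finset.range d, ζ ^ i = 0 := by
  rw [geom_sum_eq h1, h, sub_self, zero_div]

/-- The primitive `d`-th root of unity `e^{2πi/d}`. -/
def rootOfUnity (d : ℕ) : ℂ := Complex.exp (2 * Real.pi * Complex.I / d)

theorem isPrimitiveRoot_rootOfUnity (d : ℕ) [NeZero d] :
    IsPrimitiveRoot (rootOfUnity d) d :=
  Complex.isPrimitiveRoot_exp d (NeZero.ne d)

theorem rootOfUnity_pow_mod (d : ℕ) [NeZero d] (k : ℕ) :
    rootOfUnity d ^ (k % d) = rootOfUnity d ^ k :=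
  (pow_eq_pow_mod k (isPrimitiveRoot_rootOfUnity d).pow_eq_one).symm

theorem norm_rootOfUnity (d : ℕ) [NeZero d] : ‖rootOfUnity d‖ = 1 :=
  (isPrimitiveRoot_rootOfUnity d).norm'_eq_one (NeZero.ne d)

theorem clockZ_pow (d t : ℕ) :
    clockZ d ^ t = Matrix.diagonal fun j : Fin d => rootOfUnity d ^ (t * (j : ℕ)) := by
  rw [clockZ, Matrix.diagonal_pow]
  congr 1
  funext j
  rw [Pi.pow_apply, rootOfUnity, ← Complex.exp_nat_mul, ← Complex.exp_nat_mul]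
  congr 1
  push_cast
  ring

theorem shiftX_pow_apply (d s : ℕ) [NeZero d] (x y : Fin d) :
    (shiftX d ^ s) x y = if (x : ℕ) = ((y : ℕ) + s) % d then 1 else 0 := by
  induction s generalizing x with
  | zero => simp [Matrix.one_apply, Fin.ext_iff, Nat.mod_eq_of_lt y.2]
  | succ s ih =>
    rw [pow_succ', Matrix.mul_apply,
      Finset.sum_eq_single (⟨((y : ℕ) + s) % d, Nat.mod_lt _ (NeZero.pos d)⟩ : Fin d)]
    · simp [ih, shiftX, ← add_assoc]
    · intro z _ hz
      rw [ih, if_neg (fun h => hz (Fin.ext h)), mul_zero]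
    · simp

theorem pauli1_apply (d : ℕ) [NeZero d] (a : ZMod d × ZMod d) (x y : Fin d) :
    pauli1 d a x y = if (x : ℕ) = ((y : ℕ) + a.1.val) % d
      then rootOfUnity d ^ (a.2.val * (y : ℕ)) else 0 := by
  rw [pauli1, clockZ_pow, Matrix.mul_diagonal, shiftX_pow_apply]
  split_ifs <;> simp

theorem shift_eq_iff (d : ℕ) [NeZero d] (x y : Fin d) (s : ZMod d) :
    (x : ℕ) = ((y : ℕ) + s.val) % d ↔ s = ((x : ℕ) : ZMod d) - ((y : ℕ) : ZMod d) := by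
  rw [eq_sub_iff_add_eq, eq_comm (b := ((x : ℕ) : ZMod d))]
  conv_rhs => rw [← ZMod.natCast_zmod_val s, ← Nat.cast_add, ZMod.natCast_eq_natCast_iff']
  rw [Nat.mod_eq_of_lt x.2, add_comm]

theorem fin_natCast_injective (d : ℕ) [NeZero d] {x y : Fin d}
    (h : ((x : ℕ) : ZMod d) = ((y : ℕ) : ZMod d)) : x = y := by
  rw [ZMod.natCast_eq_natCast_iff', Nat.mod_eq_of_lt x.2, Nat.mod_eq_of_lt y.2] at h
  exact Fin.ext h

theorem pauli1_zero (d : ℕ) [NeZero d] : pauli1 d 0 = 1 := by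
  simp [pauli1]

/-- Completeness of the single-qudit Pauli operators. -/
theorem sum_pauli1_mul_conj (d : ℕ) [NeZero d] (x y x' y' : Fin d) :
    ∑ a : ZMod d × ZMod d, pauli1 d a x y * starRingEnd ℂ (pauli1 d a x' y') =
      if x = x' ∧ y = y' then (d : ℂ) else 0 := by
  have hω := isPrimitiveRoot_rootOfUnity d
  set ω := rootOfUnity d with hωdef
  have hconj : ω * starRingEnd ℂ ω = 1 := by
    rw [Complex.mul_conj, Complex.normSq_eq_norm_sq, norm_rootOfUnity]; simp
  have key : ∀ s : ZMod d, ∑ t : ZMod d, pauli1 d (s, t) x y * starRingEnd ℂ (pauli1 d (s, t) x' y')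
      = if s = ((x : ℕ) : ZMod d) - ((y : ℕ) : ZMod d) then
          (if s = ((x' : ℕ) : ZMod d) - ((y' : ℕ) : ZMod d) then
            (if y = y' then (d : ℂ) else 0) else 0) else 0 := by
    intro s
    simp only [pauli1_apply, shift_eq_iff]
    by_cases h1 : s = ((x : ℕ) : ZMod d) - ((y : ℕ) : ZMod d)
    swap
    · simp [h1]
    by_cases h2 : s = ((x' : ℕ) : ZMod d) - ((y' : ℕ) : ZMod d)
    swap
    · simp [h2]
    rw [if_pos h1, if_pos h2]
    simp only [if_pos h1, if_pos h2]
    have hs : ∀ t : ZMod d, ω ^ (t.val * (y : ℕ)) * starRingEnd ℂ (ω ^ (t.val * (y' : ℕ))) =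
        (ω ^ (y : ℕ) * starRingEnd ℂ ω ^ (y' : ℕ)) ^ t.val := by
      intro t
      rw [map_pow, mul_pow, ← pow_mul, ← pow_mul, mul_comm (y : ℕ), mul_comm (y' : ℕ)]
    simp only [← hωdef, hs]
    rw [sum_zmod_val d (fun k => (ω ^ (y : ℕ) * starRingEnd ℂ ω ^ (y' : ℕ)) ^ k)]
    by_cases hy : y = y'
    · subst hy
      simp [← mul_pow, hconj]
    · rw [if_neg hy]
      apply sum_range_pow_of_pow_eq_one
      · rw [mul_pow, ← pow_mul, ← pow_mul, mul_comm (y : ℕ), mul_comm (y' : ℕ), pow_mul, pow_mul,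
          ← map_pow, hω.pow_eq_one]
        simp
      · intro h
        apply hy
        refine Fin.ext (hω.pow_inj y.2 y'.2 ?_)
        calc ω ^ (y : ℕ) = ω ^ (y : ℕ) * (ω * starRingEnd ℂ ω) ^ (y' : ℕ) := by simp [hconj]
          _ = (ω ^ (y : ℕ) * starRingEnd ℂ ω ^ (y' : ℕ)) * ω ^ (y' : ℕ) := by ring
          _ = ω ^ (y' : ℕ) := by rw [h, one_mul]
  rw [Fintype.sum_prod_type]
  simp only [key, Finset.sum_ite_eq', Finset.mem_univ, if_true]
  by_cases hy : y = y'
  · subst hy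
    simp only [sub_left_inj, and_true, if_true]
    by_cases hx : x = x'
    · simp [hx]
    · rw [if_neg hx, if_neg (fun h => hx (fin_natCast_injective d h))]
  · simp [hy]

/-- Two single-qudit Pauli operators have vanishing `Tr(P_a P_b)` unless `b = -a`. -/
theorem trace_pauli1_mul (d : ℕ) [NeZero d] (a b : ZMod d × ZMod d) (h : a + b ≠ 0) :
    (pauli1 d a * pauli1 d b).trace = 0 := by
  have hω := isPrimitiveRoot_rootOfUnity d
  simp only [Matrix.trace, Matrix.diag, Matrix.mul_apply]
  rw [Finset.sum_comm]
  by_cases h1 : a.1 + b.1 = 0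
  swap
  · refine Finset.sum_eq_zero fun y _ => Finset.sum_eq_zero fun x _ => ?_
    simp only [pauli1_apply, shift_eq_iff]
    by_cases ha : a.1 = ((x : ℕ) : ZMod d) - ((y : ℕ) : ZMod d)
    · rw [if_neg (c := b.1 = _), mul_zero]
      intro hb
      apply h1
      rw [ha, hb]
      ring
    · rw [if_neg ha, zero_mul]
  · have h2 : a.2 + b.2 ≠ 0 := fun h2 => h (Prod.ext h1 h2)
    have inner : ∀ y : Fin d, ∑ x : Fin d, pauli1 d a x y * pauli1 d b y x =
        rootOfUnity d ^ (b.2.val * a.1.val) * (rootOfUnity d ^ (a.2.val + b.2.val)) ^ (y : ℕ) := by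
      intro y
      rw [Finset.sum_eq_single (⟨((y : ℕ) + a.1.val) % d, Nat.mod_lt _ (NeZero.pos d)⟩ : Fin d)]
      · have hb : (y : ℕ) = (((⟨((y : ℕ) + a.1.val) % d, Nat.mod_lt _ (NeZero.pos d)⟩ : Fin d) : ℕ)
            + b.1.val) % d := by
          rw [shift_eq_iff]
          simp only [ZMod.natCast_mod, Nat.cast_add, ZMod.natCast_zmod_val]
          rw [eq_neg_of_add_eq_zero_right h1]
          ring
        rw [pauli1_apply, pauli1_apply, if_pos rfl, if_pos hb]
        simp only
        rw [mul_comm b.2.val, pow_mul (rootOfUnity d) (_ % d), rootOfUnity_pow_mod]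
        ring
      · intro x _ hx
        rw [pauli1_apply, if_neg (fun h => hx (Fin.ext h)), zero_mul]
      · simp
    simp only [inner]
    rw [← Finset.mul_sum,
      Fin.sum_univ_eq_sum_range (fun k => (rootOfUnity d ^ (a.2.val + b.2.val)) ^ k),
      sum_range_pow_of_pow_eq_one, mul_zero]
    · rw [← pow_mul, mul_comm, pow_mul, hω.pow_eq_one, one_pow]
    · intro h
      apply h2
      have := (ZMod.natCast_eq_zero_iff _ _).2 ((hω.pow_eq_one_iff_dvd _).1 h)
      simpa using this

theorem sum_norm_sq_pauli1 (d : ℕ) [NeZero d] (a : ZMod d × ZMod d) :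
    ∑ x : Fin d, ∑ y : Fin d, ‖pauli1 d a x y‖ ^ 2 = d := by
  rw [Finset.sum_comm]
  have : ∀ y : Fin d, ∑ x : Fin d, ‖pauli1 d a x y‖ ^ 2 = 1 := by
    intro y
    rw [Finset.sum_eq_single (⟨((y : ℕ) + a.1.val) % d, Nat.mod_lt _ (NeZero.pos d)⟩ : Fin d)]
    · rw [pauli1_apply, if_pos rfl]
      simp [norm_rootOfUnity]
    · intro x _ hx
      rw [pauli1_apply, if_neg (fun h => hx (Fin.ext h))]
      simp
    · simp
  simp [this]

theorem pauliN_zero (d n : ℕ) [NeZero d] : pauliN d n 0 = 1 := by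
  ext x y
  simp only [pauliN, Pi.zero_apply, pauli1_zero, Matrix.one_apply, funext_iff]
  by_cases h : ∀ i, x i = y i
  · simp [h]
  · rw [if_neg h]
    obtain ⟨i, hi⟩ := not_forall.1 h
    exact Finset.prod_eq_zero (Finset.mem_univ i) (if_neg hi)

/-- Completeness of the `n`-qudit Pauli operators. -/
theorem sum_pauliN_mul_conj (d n : ℕ) [NeZero d] (x y x' y' : Fin n → Fin d) :
    ∑ a : Fin n → ZMod d × ZMod d, pauliN d n a x y * starRingEnd ℂ (pauliN d n a x' y') =
      if x = x' ∧ y = y' then (d : ℂ) ^ n else 0 := by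
  simp only [pauliN, map_prod, ← Finset.prod_mul_distrib]
  have := Finset.prod_univ_sum (fun _ : Fin n => (Finset.univ : Finset (ZMod d × ZMod d)))
    (fun i b => pauli1 d b (x i) (y i) * starRingEnd ℂ (pauli1 d b (x' i) (y' i)))
  rw [Fintype.piFinset_univ] at this
  rw [← this]
  simp only [sum_pauli1_mul_conj]
  by_cases h : x = x' ∧ y = y'
  · obtain ⟨rfl, rfl⟩ := h
    simp
  · rw [if_neg h]
    have : ∃ i, ¬(x i = x' i ∧ y i = y' i) := by
      by_contra! hc
      exact h ⟨funext fun i => (hc i).1, funext fun i => (hc i).2⟩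
    obtain ⟨i, hi⟩ := this
    exact Finset.prod_eq_zero (Finset.mem_univ i) (if_neg hi)

theorem sum_sum_prod_apply {R : Type*} [CommSemiring R] (d n : ℕ)
    (f : Fin n → Fin d → Fin d → R) :
    ∑ x : Fin n → Fin d, ∑ y : Fin n → Fin d, ∏ i, f i (x i) (y i) =
      ∏ i, ∑ x : Fin d, ∑ y : Fin d, f i x y := by
  rw [Finset.prod_univ_sum, Fintype.piFinset_univ]
  refine Finset.sum_congr rfl fun x _ => ?_
  rw [Finset.prod_univ_sum, Fintype.piFinset_univ]

theorem trace_pauliN_mul (d n : ℕ) (a b : Fin n → ZMod d × ZMod d) :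
    (pauliN d n a * pauliN d n b).trace = ∏ i, (pauli1 d (a i) * pauli1 d (b i)).trace := by
  simp only [Matrix.trace, Matrix.diag, Matrix.mul_apply, pauliN, ← Finset.prod_mul_distrib]
  exact sum_sum_prod_apply d n fun i x y => pauli1 d (a i) x y * pauli1 d (b i) y x

theorem trace_pauliN_mul_eq_zero (d n : ℕ) [NeZero d] (a b : Fin n → ZMod d × ZMod d)
    (h : a + b ≠ 0) : (pauliN d n a * pauliN d n b).trace = 0 := by
  obtain ⟨i, hi⟩ := Function.ne_iff.1 h
  rw [trace_pauliN_mul]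
  exact Finset.prod_eq_zero (Finset.mem_univ i) (trace_pauli1_mul d _ _ hi)

theorem trace_conjTranspose_mul_self (d n : ℕ) (O : QOp d n) :
    (Oᴴ * O).trace = ((∑ x, ∑ y, ‖O x y‖ ^ 2 : ℝ) : ℂ) := by
  simp only [Matrix.trace, Matrix.diag, Matrix.mul_apply, Matrix.conjTranspose_apply]
  rw [Finset.sum_comm]
  push_cast
  refine Finset.sum_congr rfl fun x _ => Finset.sum_congr rfl fun y _ => ?_
  exact Complex.conj_mul' _

theorem l2norm_pauliN (d n : ℕ) [NeZero d] (a : Fin n → ZMod d × ZMod d) :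
    l2norm d n (pauliN d n a) = 1 := by
  have hd : (d : ℝ) ≠ 0 := Nat.cast_ne_zero.2 (NeZero.ne d)
  rw [l2norm, trace_conjTranspose_mul_self, Complex.ofReal_re]
  simp only [pauliN, norm_prod, ← Finset.prod_pow]
  rw [sum_sum_prod_apply d n fun i x y => ‖pauli1 d (a i) x y‖ ^ 2]
  simp [sum_norm_sq_pauli1, hd]

/-- Parseval's identity for the Pauli basis. -/
theorem sum_pdist (d n : ℕ) [NeZero d] (O : QOp d n) :
    ∑ a, pdist d n O a = l2norm d n O ^ 2 := by
  have hd : (d : ℝ) ≠ 0 := Nat.cast_ne_zero.2 (NeZero.ne d)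
  have key : ∑ a, ‖(O * pauliN d n a).trace‖ ^ 2 = d ^ n * ∑ x, ∑ y, ‖O x y‖ ^ 2 := by
    apply Complex.ofReal_injective
    push_cast
    simp only [← Complex.mul_conj']
    have expand : ∀ a, (O * pauliN d n a).trace =
        ∑ p : (Fin n → Fin d) × (Fin n → Fin d), O p.1 p.2 * pauliN d n a p.2 p.1 := by
      intro a
      simp only [Matrix.trace, Matrix.diag, Matrix.mul_apply, Fintype.sum_prod_type]
    simp only [expand, map_sum, Finset.sum_mul_sum, map_mul]
    rw [Finset.sum_comm]
    rw [← Fintype.sum_prod_type' (f := fun x y => O x y * starRingEnd ℂ (O x y)), Finset.mul_sum]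
    refine Finset.sum_congr rfl fun p _ => ?_
    rw [Finset.sum_comm]
    have inner : ∀ q : (Fin n → Fin d) × (Fin n → Fin d),
        ∑ a, O p.1 p.2 * pauliN d n a p.2 p.1 *
          (starRingEnd ℂ (O q.1 q.2) * starRingEnd ℂ (pauliN d n a q.2 q.1)) =
        if q = p then (d : ℂ) ^ n * (O p.1 p.2 * starRingEnd ℂ (O q.1 q.2)) else 0 := by
      intro q
      have : ∀ a, O p.1 p.2 * pauliN d n a p.2 p.1 *
          (starRingEnd ℂ (O q.1 q.2) * starRingEnd ℂ (pauliN d n a q.2 q.1)) =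
          (O p.1 p.2 * starRingEnd ℂ (O q.1 q.2)) *
            (pauliN d n a p.2 p.1 * starRingEnd ℂ (pauliN d n a q.2 q.1)) := fun a => by ring
      simp only [this]
      rw [← Finset.mul_sum, sum_pauliN_mul_conj]
      by_cases h : q = p
      · subst h; simp [mul_comm]
      · rw [if_neg h, if_neg (fun h' => h (Prod.ext h'.2.symm h'.1.symm)), mul_zero]
    simp only [inner, Finset.sum_ite_eq', Finset.mem_univ, if_true]
  simp only [pdist]
  rw [← Finset.sum_div, key, l2norm, trace_conjTranspose_mul_self, Complex.ofReal_re,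
    Real.sq_sqrt (by positivity)]
  field_simp
  ring

theorem pdist_nonneg (d n : ℕ) (O : QOp d n) (a : Fin n → ZMod d × ZMod d) :
    0 ≤ pdist d n O a := by
  unfold pdist; positivity

theorem influence_nonneg (d n : ℕ) [NeZero d] (O : QOp d n) : 0 ≤ influence d n O :=
  Finset.sum_nonneg fun a _ => mul_nonneg (Nat.cast_nonneg _) (pdist_nonneg d n O a)

theorem influence_le (d n : ℕ) [NeZero d] (O : QOp d n) (hO : l2norm d n O = 1) :
    influence d n O ≤ n := by
  calc influence d n O ≤ ∑ a, (n : ℝ) * pdist d n O a := by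
        refine Finset.sum_le_sum fun a _ =>
          mul_le_mul_of_nonneg_right ?_ (pdist_nonneg d n O a)
        exact_mod_cast (Finset.card_le_univ _).trans_eq (Fintype.card_fin n)
    _ = n := by rw [← Finset.mul_sum, sum_pdist, hO]; simp

theorem weight_neg (d n : ℕ) (a : Fin n → ZMod d × ZMod d) : weight d n (-a) = weight d n a := by
  simp [weight]

theorem influence_pauliN (d n : ℕ) [NeZero d] (a : Fin n → ZMod d × ZMod d) :
    influence d n (pauliN d n a) = weight d n a := by
  have : ∀ b, (weight d n b : ℝ) * pdist d n (pauliN d n a) b =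
      weight d n a * pdist d n (pauliN d n a) b := by
    intro b
    by_cases h : a + b = 0
    · rw [eq_neg_of_add_eq_zero_right h, weight_neg]
    · simp [pdist, trace_pauliN_mul_eq_zero d n a b h]
  rw [influence, Finset.sum_congr rfl fun b _ => this b, ← Finset.mul_sum, sum_pdist,
    l2norm_pauliN]
  simp

theorem l2norm_conj (d n : ℕ) (U O : QOp d n)
    (hU : U ∈ Matrix.unitaryGroup (Fin n → Fin d) ℂ) :
    l2norm d n (U * O * Uᴴ) = l2norm d n O := by
  have h : Uᴴ * U = 1 := Matrix.mem_unitaryGroup_iff'.1 hU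
  have : (U * O * Uᴴ)ᴴ * (U * O * Uᴴ) = U * (Oᴴ * O) * Uᴴ := by
    simp only [Matrix.conjTranspose_mul, Matrix.conjTranspose_conjTranspose, Matrix.mul_assoc]
    rw [← Matrix.mul_assoc Uᴴ U, h, Matrix.one_mul]
  rw [l2norm, this, Matrix.trace_mul_comm, ← Matrix.mul_assoc, h, Matrix.one_mul, l2norm]

theorem abs_influence_sub_le_cis (d n : ℕ) [NeZero d] (U O : QOp d n)
    (hU : U ∈ Matrix.unitaryGroup (Fin n → Fin d) ℂ) (hO : l2norm d n O = 1) :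
    |influence d n (U * O * Uᴴ) - influence d n O| ≤ CiS d n U := by
  refine le_csSup ⟨n, ?_⟩ ⟨O, hO, rfl⟩
  rintro _ ⟨A, hA, rfl⟩
  have h1 := influence_le d n _ ((l2norm_conj d n U A hU).trans hA)
  have h2 := influence_le d n A hA
  have h3 := influence_nonneg d n A
  have h4 := influence_nonneg d n (U * A * Uᴴ)
  rw [abs_le]
  constructor <;> linarith

theorem cis_nonneg (d n : ℕ) [NeZero d] (U : QOp d n) : 0 ≤ CiS d n U := by
  refine Real.sSup_nonneg ?_
  rintro _ ⟨O, -, rfl⟩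
  exact abs_nonneg _

/-- The weight enumerator of the Pauli group. -/
theorem sum_pow_weight (d n : ℕ) [NeZero d] (w : ℝ) :
    ∑ a : Fin n → ZMod d × ZMod d, w ^ weight d n a = (1 + ((d : ℝ) ^ 2 - 1) * w) ^ n := by
  have h1 : ∀ a : Fin n → ZMod d × ZMod d,
      w ^ weight d n a = ∏ i, if a i ≠ 0 then w else 1 := by
    intro a
    rw [Finset.prod_ite]
    simp [weight]
  have h2 : ∑ b : ZMod d × ZMod d, (if b ≠ 0 then w else 1) = 1 + ((d : ℝ) ^ 2 - 1) * w := by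
    have : ∀ b : ZMod d × ZMod d, (if b ≠ 0 then w else 1) = w + if b = 0 then 1 - w else 0 := by
      intro b
      split_ifs <;> simp_all
    simp only [this, Finset.sum_add_distrib, Finset.sum_ite_eq', Finset.mem_univ, if_true]
    simp [ZMod.card]
    ring
  simp only [h1]
  have := Finset.prod_univ_sum (fun _ : Fin n => (Finset.univ : Finset (ZMod d × ZMod d)))
    (fun _ b => if b ≠ 0 then w else 1)
  rw [Fintype.piFinset_univ] at this
  rw [← this, h2]
  simp

theorem neg_mul_log_le {p q : ℝ} (hp : 0 ≤ p) (hq : 0 < q) :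
    -(p * Real.log p) ≤ -(p * Real.log q) + (q - p) := by
  rcases hp.eq_or_lt with rfl | hp
  · simpa using hq.le
  · have h := Real.log_le_sub_one_of_pos (div_pos hq hp)
    rw [Real.log_div hq.ne' hp.ne'] at h
    have h' := mul_le_mul_of_nonneg_left h hp.le
    have : p * (q / p - 1) = q - p := by field_simp
    linarith

/-- Gibbs' inequality against a sub-probability weight on a finite set. -/
theorem neg_sum_mul_logb_le {ι : Type*} (s : Finset ι) (p q : ι → ℝ) (hp : ∀ i ∈ s, 0 ≤ p i)
    (hq : ∀ i ∈ s, 0 < q i) (hsum : ∑ i ∈ s, q i ≤ ∑ i ∈ s, p i) :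
    -∑ i ∈ s, p i * Real.logb 2 (p i) ≤ -∑ i ∈ s, p i * Real.logb 2 (q i) := by
  have h : -∑ i ∈ s, p i * Real.log (p i) ≤ -∑ i ∈ s, p i * Real.log (q i) := by
    have := Finset.sum_le_sum fun i hi => neg_mul_log_le (hp i hi) (hq i hi)
    rw [Finset.sum_add_distrib, Finset.sum_sub_distrib, Finset.sum_neg_distrib,
      Finset.sum_neg_distrib] at this
    linarith
  simp only [Real.logb, ← mul_div_assoc, ← Finset.sum_div, ← neg_div]
  exact div_le_div_of_nonneg_right h (Real.log_nonneg one_le_two)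

theorem one_add_pow_le_two {n d : ℕ} (hn : 2 ≤ n) (hd : 2 ≤ d) :
    (1 + ((d : ℝ) ^ 2 - 1) * ((n : ℝ) ^ 2 * (d : ℝ) ^ 2)⁻¹) ^ n ≤ 2 := by
  have hn' : (2 : ℝ) ≤ n := by exact_mod_cast hn
  have hd' : (2 : ℝ) ≤ d := by exact_mod_cast hd
  have h1 : ((d : ℝ) ^ 2 - 1) * ((n : ℝ) ^ 2 * (d : ℝ) ^ 2)⁻¹ ≤ ((n : ℝ) ^ 2)⁻¹ := by
    rw [← div_eq_mul_inv, div_le_iff₀ (by positivity)]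
    field_simp
    linarith
  have h0 : 0 ≤ ((d : ℝ) ^ 2 - 1) * ((n : ℝ) ^ 2 * (d : ℝ) ^ 2)⁻¹ :=
    mul_nonneg (by nlinarith) (by positivity)
  calc _ ≤ (Real.exp (((n : ℝ) ^ 2)⁻¹)) ^ n := by
        refine pow_le_pow_left₀ (by linarith) ?_ n
        linarith [Real.add_one_le_exp (((n : ℝ) ^ 2)⁻¹)]
    _ = Real.exp ((n : ℝ)⁻¹) := by
        rw [← Real.exp_nat_mul]
        congr 1
        field_simp
    _ ≤ Real.exp (Real.log 2) := by
        refine Real.exp_le_exp.2 ?_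
        have : (n : ℝ)⁻¹ ≤ 2⁻¹ := inv_anti₀ two_pos hn'
        linarith [Real.log_two_gt_d9]
    _ = 2 := Real.exp_log two_pos

/-- The Fourier entropy of a traceless operator is controlled by its influence. -/
theorem qEntropy_le_influence {n d : ℕ} (hn : 2 ≤ n) (hd : 2 ≤ d) [NeZero d] (O : QOp d n)
    (hO : l2norm d n O = 1) (htr : O.trace = 0) :
    qEntropy d n O ≤ 2 * (Real.logb 2 n + Real.logb 2 d) * influence d n O := by
  have hn0 : (n : ℝ) ≠ 0 := by positivity
  have hd0 : (d : ℝ) ≠ 0 := by positivity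
  set w : ℝ := ((n : ℝ) ^ 2 * (d : ℝ) ^ 2)⁻¹ with hw
  have hwpos : 0 < w := by positivity
  have hp0 : pdist d n O 0 = 0 := by simp [pdist, pauliN_zero, htr]
  have hlog : Real.logb 2 w = -(2 * (Real.logb 2 n + Real.logb 2 d)) := by
    rw [hw, Real.logb_inv, Real.logb_mul (by positivity) (by positivity), Real.logb_pow,
      Real.logb_pow]
    push_cast
    ring
  have hqsum : ∑ a ∈ Finset.univ.erase (0 : Fin n → ZMod d × ZMod d), w ^ weight d n a ≤ 1 := by
    have h1 := Finset.add_sum_erase Finset.univ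
      (fun a : Fin n → ZMod d × ZMod d => w ^ weight d n a) (Finset.mem_univ 0)
    have h2 : weight d n 0 = 0 := by simp [weight]
    have h3 := one_add_pow_le_two hn hd
    rw [← hw, ← sum_pow_weight, ← h1, h2, pow_zero] at h3
    linarith
  have hpsum : ∑ a ∈ Finset.univ.erase (0 : Fin n → ZMod d × ZMod d), pdist d n O a = 1 := by
    rw [Finset.sum_erase _ hp0, sum_pdist, hO, one_pow]
  have gibbs := neg_sum_mul_logb_le (Finset.univ.erase (0 : Fin n → ZMod d × ZMod d))
    (pdist d n O) (fun a => w ^ weight d n a) (fun a _ => pdist_nonneg d n O a)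
    (fun a _ => pow_pos hwpos _) (hqsum.trans_eq hpsum.symm)
  rw [Finset.sum_erase _ (by simp [hp0]), Finset.sum_erase _ (by simp [hp0])] at gibbs
  refine gibbs.trans_eq ?_
  rw [influence, Finset.mul_sum, ← Finset.sum_neg_distrib]
  refine Finset.sum_congr rfl fun a _ => ?_
  rw [Real.logb_pow, hlog]
  ring

/-- **Magic–sensitivity relation**: `M[U] ≤ 2 (log n + log d)(CiS[U] + 1)`. -/
theorem magicEntropy_le_cis (n d : ℕ) (hn : 2 ≤ n) (hd : 2 ≤ d) [NeZero d]
    (U : QOp d n) (hU : U ∈ Matrix.unitaryGroup (Fin n → Fin d) ℂ) :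
    magicEntropy d n U ≤ 2 * (Real.logb 2 n + Real.logb 2 d) * (CiS d n U + 1) := by
  have hlog : 0 ≤ 2 * (Real.logb 2 n + Real.logb 2 d) := by
    have h1 : 0 ≤ Real.logb 2 n :=
      Real.logb_nonneg one_lt_two (by exact_mod_cast one_le_two.trans hn)
    have h2 : 0 ≤ Real.logb 2 d :=
      Real.logb_nonneg one_lt_two (by exact_mod_cast one_le_two.trans hd)
    positivity
  refine Real.sSup_le ?_ (mul_nonneg hlog (by linarith [cis_nonneg d n U]))
  rintro _ ⟨a, ha, rfl⟩
  have hP := l2norm_pauliN d n a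
  have htr : (U * pauliN d n a * Uᴴ).trace = 0 := by
    have ha0 : a + 0 ≠ 0 := by
      rintro h
      rw [add_zero] at h
      simp [h, weight] at ha
    rw [Matrix.trace_mul_comm, ← Matrix.mul_assoc, ← Matrix.star_eq_conjTranspose,
      Matrix.mem_unitaryGroup_iff'.1 hU, Matrix.one_mul]
    simpa [pauliN_zero] using trace_pauliN_mul_eq_zero d n a 0 ha0
  refine (qEntropy_le_influence hn hd _ ((l2norm_conj d n U _ hU).trans hP) htr).trans
    (mul_le_mul_of_nonneg_left ?_ hlog)
  have h1 := (le_abs_self _).trans (abs_influence_sub_le_cis d n U _ hU hP)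
  rw [influence_pauliN, ha] at h1
  push_cast at h1
  linarith

end QC
end
end

section
/- Let 1 ≤ k ≤ n, let H₀ be a Hermitian operator on (ℂ^d)^{⊗k}, and let H = H₀ ⊗ I act on (ℂ^d)^{⊗n} (acting nontrivially only on the first k qudits). Then for every density matrix ρ on (ℂ^d)^{⊗n} all of whose diagonal entries (in the computational basis) are positive, the coherence rate satisfies |R_C(H,ρ)| ≤ 4·‖H‖∞·k·log d. -/
open Matrix Complex BigOperators
open scoped ComplexOrder
noncomputable section

namespace QC

open scoped MatrixOrder Matrix.Norms.L2Operator in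
theorem exists_eq_conjTranspose_mul_self {ι : Type*} [Fintype ι] [DecidableEq ι]
    {ρ : Matrix ι ι ℂ} (hρ : ρ.PosSemidef) : ∃ B : Matrix ι ι ℂ, ρ = Bᴴ * B :=
  CStarAlgebra.nonneg_iff_eq_star_mul_self.mp hρ.nonneg

/-- Cauchy–Schwarz in AM-GM form for the sesquilinear form of a matrix. -/
theorem norm_star_dotProduct_mulVec_le {ι : Type*} [Fintype ι] [DecidableEq ι]
    (A : Matrix ι ι ℂ) (u v : ι → ℂ) {t : ℝ} (ht : 0 < t) :
    ‖star u ⬝ᵥ A *ᵥ v‖ ≤ ‖Matrix.toEuclideanCLM (𝕜 := ℂ) (n := ι) A‖ *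
      ((∑ x, ‖u x‖ ^ 2) / t + t * ∑ x, ‖v x‖ ^ 2) / 2 := by
  have h1 : star u ⬝ᵥ A *ᵥ v = inner ℂ (WithLp.toLp 2 u)
      (Matrix.toEuclideanCLM (𝕜 := ℂ) (n := ι) A (WithLp.toLp 2 v)) := by
    rw [Matrix.toEuclideanCLM_toLp, EuclideanSpace.inner_toLp_toLp, dotProduct_comm]
  have h2 := (norm_inner_le_norm (𝕜 := ℂ) (WithLp.toLp 2 u)
    (Matrix.toEuclideanCLM (𝕜 := ℂ) (n := ι) A (WithLp.toLp 2 v))).trans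
    (mul_le_mul_of_nonneg_left (ContinuousLinearMap.le_opNorm _ _) (norm_nonneg _))
  rw [← h1] at h2
  have hu : ∑ x, ‖u x‖ ^ 2 = ‖(WithLp.toLp 2 u : EuclideanSpace ℂ ι)‖ ^ 2 := by
    rw [EuclideanSpace.norm_sq_eq]
  have hv : ∑ x, ‖v x‖ ^ 2 = ‖(WithLp.toLp 2 v : EuclideanSpace ℂ ι)‖ ^ 2 := by
    rw [EuclideanSpace.norm_sq_eq]
  rw [hu, hv]
  set a := ‖(WithLp.toLp 2 u : EuclideanSpace ℂ ι)‖
  set b := ‖(WithLp.toLp 2 v : EuclideanSpace ℂ ι)‖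
  set c := ‖Matrix.toEuclideanCLM (𝕜 := ℂ) (n := ι) A‖
  have hab : a * b ≤ (a ^ 2 / t + t * b ^ 2) / 2 := by
    have h : (a ^ 2 / t + t * b ^ 2) / 2 - a * b = (a - t * b) ^ 2 / (2 * t) := by
      field_simp
      ring
    have : 0 ≤ (a - t * b) ^ 2 / (2 * t) := by positivity
    linarith
  calc _ ≤ a * (c * b) := h2
    _ = c * (a * b) := by ring
    _ ≤ c * ((a ^ 2 / t + t * b ^ 2) / 2) := mul_le_mul_of_nonneg_left hab (norm_nonneg _)
    _ = _ := by ring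

/-- If the second moment of the diagonal observable `m` in the state `ρ` is at most `t ^ 2`,
then `|Tr(ρ m A)| ≤ ‖A‖ t`. -/
theorem norm_trace_mul_diagonal_mul_le {ι : Type*} [Fintype ι] [DecidableEq ι]
    (A ρ : Matrix ι ι ℂ) (hρ : ρ.PosSemidef) (htr : ρ.trace = 1) (m : ι → ℝ) {t : ℝ}
    (ht : 0 < t) (hm : ∑ x, (ρ x x).re * m x ^ 2 ≤ t ^ 2) :
    ‖(ρ * diagonal (fun x => (m x : ℂ)) * A).trace‖ ≤
      ‖Matrix.toEuclideanCLM (𝕜 := ℂ) (n := ι) A‖ * t := by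
  obtain ⟨B, rfl⟩ := exists_eq_conjTranspose_mul_self hρ
  have hdiag : ∀ x, ((Bᴴ * B) x x).re = ∑ j, ‖B j x‖ ^ 2 := by
    intro x
    simp only [Matrix.mul_apply, Matrix.conjTranspose_apply, Complex.re_sum]
    refine Finset.sum_congr rfl fun j _ => ?_
    rw [← Complex.normSq_eq_norm_sq, Complex.normSq_apply]
    simp
  have htr' : ∑ j, ∑ x, ‖B j x‖ ^ 2 = 1 := by
    rw [Finset.sum_comm]
    have := congrArg Complex.re htr
    simp only [Matrix.trace, Matrix.diag, Complex.re_sum, hdiag, Complex.one_re] at this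
    exact this
  have hm' : ∑ j, ∑ x, ‖(m x : ℂ) * star (B j x)‖ ^ 2 ≤ t ^ 2 := by
    rw [Finset.sum_comm]
    refine le_trans (le_of_eq ?_) hm
    refine Finset.sum_congr rfl fun x _ => ?_
    rw [hdiag, Finset.sum_mul]
    refine Finset.sum_congr rfl fun j _ => ?_
    rw [norm_mul, mul_pow, norm_star, Complex.norm_real, Real.norm_eq_abs, sq_abs, mul_comm]
  have key : (Bᴴ * B * diagonal (fun x => (m x : ℂ)) * A).trace =
      ∑ j, star (fun x => (m x : ℂ) * star (B j x)) ⬝ᵥ A *ᵥ (fun x => star (B j x)) := by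
    rw [Matrix.mul_assoc, Matrix.mul_assoc, Matrix.trace_mul_comm]
    refine Finset.sum_congr rfl fun j _ => ?_
    rw [Matrix.diag_apply, ← Matrix.mul_assoc, Matrix.mul_assoc (B * _), Matrix.mul_apply]
    refine Finset.sum_congr rfl fun x _ => ?_
    rw [Matrix.mul_diagonal, Matrix.mul_apply]
    simp [Matrix.mulVec, dotProduct, mul_comm]
  rw [key]
  set c := ‖Matrix.toEuclideanCLM (𝕜 := ℂ) (n := ι) A‖ with hc
  have hc0 : 0 ≤ c := norm_nonneg _
  calc _ ≤ ∑ j, c * ((∑ x, ‖(m x : ℂ) * star (B j x)‖ ^ 2) / t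
        + t * ∑ x, ‖star (B j x)‖ ^ 2) / 2 :=
        norm_sum_le_of_le _ fun j _ => norm_star_dotProduct_mulVec_le A _ _ ht
    _ = c * ((∑ j, ∑ x, ‖(m x : ℂ) * star (B j x)‖ ^ 2) / t
        + t * ∑ j, ∑ x, ‖B j x‖ ^ 2) / 2 := by
      simp only [norm_star]
      rw [← Finset.sum_div, ← Finset.mul_sum, Finset.sum_add_distrib, ← Finset.sum_div,
        ← Finset.mul_sum]
    _ ≤ c * (t ^ 2 / t + t * 1) / 2 := by
      rw [htr']
      gcongr
    _ = c * t := by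
      field_simp
      ring

theorem mul_log_sq_le_one {r : ℝ} (h0 : 0 < r) (h1 : r ≤ 1) : r * Real.log r ^ 2 ≤ 1 := by
  set s := Real.sqrt r with hs
  have hs0 : 0 < s := Real.sqrt_pos.mpr h0
  have hr : r = s ^ 2 := (Real.sq_sqrt h0.le).symm
  have hs1 : s ≤ 1 := by
    rw [hs]
    exact Real.sqrt_le_one.mpr h1
  have hlog : Real.log r = 2 * Real.log s := by
    rw [hr, Real.log_pow]
    norm_num
  have hneg : Real.log s ≤ 0 := Real.log_nonpos hs0.le hs1
  have h2 : -Real.log s ≤ s⁻¹ / 2 := by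
    have h := Real.log_le_sub_one_of_pos (x := s⁻¹ / 2) (by positivity)
    rw [Real.log_div (by positivity) (by norm_num), Real.log_inv] at h
    linarith [Real.log_two_lt_d9]
  have h3 : 2 * s * -Real.log s ≤ 1 := by
    calc 2 * s * -Real.log s ≤ 2 * s * (s⁻¹ / 2) := by gcongr
      _ = 1 := by field_simp
  have h4 : 0 ≤ 2 * s * -Real.log s := mul_nonneg (by positivity) (by linarith)
  rw [hlog, hr]
  nlinarith

/-- Pointwise bound on the second moment of the conditional surprisal. -/
theorem mul_logb_sq_le {p q D : ℝ} (hp : 0 < p) (hpq : p ≤ q) (hD : 2 ≤ D) :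
    p * Real.logb 2 (p * D / q) ^ 2 ≤
      p * Real.logb 2 D ^ 2 + q / D / Real.log 2 ^ 2 := by
  have hq : 0 < q := hp.trans_le hpq
  have hD0 : 0 < D := by linarith
  have hr0 : 0 < p * D / q := by positivity
  rcases le_total 1 (p * D / q) with h | h
  · have hrD : p * D / q ≤ D := by
      rw [div_le_iff₀ hq]
      nlinarith
    have h1 : 0 ≤ Real.logb 2 (p * D / q) := Real.logb_nonneg (by norm_num) h
    have h2 : Real.logb 2 (p * D / q) ≤ Real.logb 2 D :=
      Real.logb_le_logb_of_le (by norm_num) hr0 hrD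
    have h3 : p * Real.logb 2 (p * D / q) ^ 2 ≤ p * Real.logb 2 D ^ 2 := by gcongr
    have h4 : 0 ≤ q / D / Real.log 2 ^ 2 := by positivity
    linarith
  · have h1 := mul_log_sq_le_one hr0 h
    have h2 : p * Real.logb 2 (p * D / q) ^ 2 =
        q / D / Real.log 2 ^ 2 * (p * D / q * Real.log (p * D / q) ^ 2) := by
      rw [Real.logb, div_pow]
      field_simp
    have h3 : q / D / Real.log 2 ^ 2 * (p * D / q * Real.log (p * D / q) ^ 2) ≤
        q / D / Real.log 2 ^ 2 := mul_le_of_le_one_right (by positivity) h1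
    have h4 : 0 ≤ p * Real.logb 2 D ^ 2 := by positivity
    linarith

/-- Two basis labels agree on all but the first `k` qudits. -/
def AgreeFrom (d k n : ℕ) (x y : Fin n → Fin d) : Prop :=
  ∀ i : Fin n, k ≤ (i : ℕ) → x i = y i

instance (d k n : ℕ) (x y : Fin n → Fin d) : Decidable (AgreeFrom d k n x y) := by
  unfold AgreeFrom
  infer_instance

theorem AgreeFrom.symm {d k n : ℕ} {x y : Fin n → Fin d} (h : AgreeFrom d k n x y) :
    AgreeFrom d k n y x := fun i hi => (h i hi).symm

theorem AgreeFrom.trans {d k n : ℕ} {x y z : Fin n → Fin d} (h : AgreeFrom d k n x y)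
    (h' : AgreeFrom d k n y z) : AgreeFrom d k n x z := fun i hi => (h i hi).trans (h' i hi)

/-- The probability, under `p`, of the last `n - k` entries of `x`. -/
def marginal (d k n : ℕ) (p : (Fin n → Fin d) → ℝ) (x : Fin n → Fin d) : ℝ :=
  ∑ y with AgreeFrom d k n x y, p y

theorem marginal_congr {d k n : ℕ} (p : (Fin n → Fin d) → ℝ) {x y : Fin n → Fin d}
    (h : AgreeFrom d k n x y) : marginal d k n p x = marginal d k n p y := by
  unfold marginal
  congr 1
  ext z
  simp only [Finset.mem_filter, Finset.mem_univ, true_and]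
  exact ⟨h.symm.trans, h.trans⟩

theorem le_marginal {d k n : ℕ} {p : (Fin n → Fin d) → ℝ} (hp : ∀ x, 0 < p x)
    (x : Fin n → Fin d) : p x ≤ marginal d k n p x :=
  Finset.single_le_sum (f := p) (fun y _ => (hp y).le)
    (Finset.mem_filter.mpr ⟨Finset.mem_univ x, fun _ _ => rfl⟩)

theorem card_agreeFrom_le {d k n : ℕ} (hkn : k ≤ n) (y : Fin n → Fin d) :
    (Finset.univ.filter fun x => AgreeFrom d k n x y).card ≤ d ^ k := by
  have h : (Finset.univ.filter fun x => AgreeFrom d k n x y).card ≤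
      (Finset.univ : Finset (Fin k → Fin d)).card := by
    refine Finset.card_le_card_of_injOn (fun x i => x (Fin.castLE hkn i))
      (fun _ _ => Finset.mem_coe.mpr (Finset.mem_univ _)) ?_
    intro x hx z hz hxz
    have hx' : AgreeFrom d k n x y := by simpa using hx
    have hz' : AgreeFrom d k n z y := by simpa using hz
    funext i
    rcases lt_or_ge (i : ℕ) k with hi | hi
    · exact congrFun hxz ⟨i, hi⟩
    · exact (hx' i hi).trans (hz' i hi).symm
  simpa using h

theorem sum_marginal_le {d k n : ℕ} (hkn : k ≤ n) {p : (Fin n → Fin d) → ℝ}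
    (hp : ∀ x, 0 < p x) : ∑ x, marginal d k n p x ≤ (d : ℝ) ^ k * ∑ x, p x := by
  simp only [marginal, Finset.sum_filter]
  rw [Finset.sum_comm, Finset.mul_sum]
  refine Finset.sum_le_sum fun y _ => ?_
  rw [← Finset.sum_filter, Finset.sum_const, nsmul_eq_mul]
  exact mul_le_mul_of_nonneg_right (by exact_mod_cast card_agreeFrom_le hkn y) (hp y).le

/-- The second moment of the conditional surprisal, shifted by `k log d`. -/
theorem sum_mul_logb_sq_le {d k n : ℕ} (hd : 2 ≤ d) (hk : 1 ≤ k) (hkn : k ≤ n)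
    {p : (Fin n → Fin d) → ℝ} (hp : ∀ x, 0 < p x) (hsum : ∑ x, p x = 1) :
    ∑ x, p x * Real.logb 2 (p x * (d : ℝ) ^ k / marginal d k n p x) ^ 2 ≤
      (2 * Real.logb 2 ((d : ℝ) ^ k)) ^ 2 := by
  set D : ℝ := (d : ℝ) ^ k with hDdef
  have hD : 2 ≤ D := by
    have h : 2 ≤ d ^ k := hd.trans (Nat.le_self_pow (by omega) d)
    rw [hDdef]
    exact_mod_cast h
  have hD0 : 0 < D := by linarith
  have hl : 1 ≤ Real.logb 2 D := by
    rw [Real.le_logb_iff_rpow_le (by norm_num) hD0]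
    simpa using hD
  have hl2 : 1 / Real.log 2 ^ 2 ≤ 3 := by
    have := Real.log_two_gt_d9
    rw [div_le_iff₀ (by positivity)]
    nlinarith
  calc _ ≤ ∑ x, (p x * Real.logb 2 D ^ 2 + marginal d k n p x / D / Real.log 2 ^ 2) :=
        Finset.sum_le_sum fun x _ => mul_logb_sq_le (hp x) (le_marginal hp x) hD
    _ = Real.logb 2 D ^ 2 + (∑ x, marginal d k n p x) / D / Real.log 2 ^ 2 := by
      rw [Finset.sum_add_distrib, ← Finset.sum_mul, hsum, one_mul, Finset.sum_div,
        Finset.sum_div]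
    _ ≤ Real.logb 2 D ^ 2 + 1 / Real.log 2 ^ 2 := by
      gcongr
      rw [div_le_one hD0]
      simpa [hsum] using sum_marginal_le hkn hp
    _ ≤ _ := by nlinarith

theorem extendOp_isHermitian {d k n : ℕ} (hkn : k ≤ n) {H0 : QOp d k} (hH0 : H0.IsHermitian) :
    (extendOp d k n hkn H0).IsHermitian := by
  ext x y
  simp only [Matrix.conjTranspose_apply, extendOp]
  by_cases h : ∀ i : Fin n, k ≤ (i : ℕ) → x i = y i
  · rw [if_pos h, if_pos fun i hi => (h i hi).symm]
    exact hH0.apply _ _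
  · rw [if_neg h, if_neg fun h' => h fun i hi => (h' i hi).symm, star_zero]

theorem diagonal_mul_extendOp_comm {d k n : ℕ} (hkn : k ≤ n) (H0 : QOp d k)
    {f : (Fin n → Fin d) → ℂ} (hf : ∀ x y, AgreeFrom d k n x y → f x = f y) :
    diagonal f * extendOp d k n hkn H0 = extendOp d k n hkn H0 * diagonal f := by
  ext x y
  rw [Matrix.diagonal_mul, Matrix.mul_diagonal]
  by_cases h : AgreeFrom d k n x y
  · rw [hf x y h, mul_comm]
  · have : extendOp d k n hkn H0 x y = 0 := if_neg h
    simp [this]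

/-- **Small incremental coherence**: if `H = H₀ ⊗ I` acts nontrivially only on the first
`k` qudits, then `|R_C(H,ρ)| ≤ 4 ‖H‖∞ k log d`. -/
theorem cohRate_le_of_local (n d k : ℕ) (hd : 2 ≤ d) (hk : 1 ≤ k) (hkn : k ≤ n)
    (H0 : QOp d k) (hH0 : H0.IsHermitian)
    (ρ : QOp d n) (hρ : ρ.PosSemidef) (htr : ρ.trace = 1)
    (hdiag : ∀ i, 0 < (ρ i i).re) :
    ‖cohRate d n (extendOp d k n hkn H0) ρ‖
      ≤ 4 * opNorm d n (extendOp d k n hkn H0) * k * Real.logb 2 d := by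
  set H := extendOp d k n hkn H0 with hH
  set p : (Fin n → Fin d) → ℝ := fun x => (ρ x x).re with hp
  set D : ℝ := (d : ℝ) ^ k with hDdef
  have hsum : ∑ x, p x = 1 := by
    have := congrArg Complex.re htr
    simpa [Matrix.trace, Complex.re_sum] using this
  have hD0 : 0 < D := by positivity
  have hl : 0 < Real.logb 2 D := by
    refine Real.logb_pos (by norm_num) ?_
    have h : 2 ≤ d ^ k := hd.trans (Nat.le_self_pow (by omega) d)
    have h' : (2 : ℝ) ≤ D := by
      rw [hDdef]
      exact_mod_cast h
    linarith
  set m : (Fin n → Fin d) → ℝ := fun x => Real.logb 2 (p x * D / marginal d k n p x) with hm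
  set f : (Fin n → Fin d) → ℝ := fun x => Real.logb 2 (marginal d k n p x) - Real.logb 2 D
    with hf
  set M : QOp d n := diagonal (fun x => (m x : ℂ)) with hM
  set N : QOp d n := diagonal (fun x => (f x : ℂ)) with hN
  have hL : logDephase d n ρ = M + N := by
    rw [logDephase, hM, hN, Matrix.diagonal_add]
    congr 1
    funext x
    have hq : 0 < marginal d k n p x := (hdiag x).trans_le (le_marginal hdiag x)
    rw [← Complex.ofReal_add]
    congr 1
    simp only [hm, hf]
    rw [Real.logb_div (mul_pos (hdiag x) hD0).ne' hq.ne', Real.logb_mul (hdiag x).ne' hD0.ne']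
    ring
  have hcomm : N * H = H * N :=
    diagonal_mul_extendOp_comm hkn H0 fun x y h => by simp only [hf, marginal_congr p h]
  have hNtr : (ρ * N * H).trace = (N * ρ * H).trace := by
    rw [Matrix.mul_assoc, hcomm, ← Matrix.mul_assoc, Matrix.trace_mul_comm, Matrix.mul_assoc]
  have hstar : (M * ρ * H).trace = star (ρ * M * H).trace := by
    have hMh : Mᴴ = M := by
      rw [hM, Matrix.diagonal_conjTranspose]
      congr 1
      funext x
      exact Complex.conj_ofReal _
    have hHh : Hᴴ = H := extendOp_isHermitian hkn hH0
    rw [← Matrix.trace_conjTranspose, Matrix.conjTranspose_mul, Matrix.conjTranspose_mul, hMh,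
      hHh, hρ.isHermitian.eq, Matrix.trace_mul_comm]
  have hrate : cohRate d n H ρ =
      -Complex.I * ((ρ * M * H).trace - star (ρ * M * H).trace) := by
    rw [cohRate, hL, ← hstar]
    congr 1
    simp only [Matrix.mul_add, Matrix.add_mul, Matrix.sub_mul, Matrix.trace_add,
      Matrix.trace_sub, hNtr]
    ring
  have hbound : ‖(ρ * M * H).trace‖ ≤ opNorm d n H * (2 * Real.logb 2 D) :=
    norm_trace_mul_diagonal_mul_le H ρ hρ htr m (by positivity)
      (sum_mul_logb_sq_le hd hk hkn hdiag hsum)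
  have hlog : Real.logb 2 D = k * Real.logb 2 d := Real.logb_pow _ _ _
  calc ‖cohRate d n H ρ‖ = ‖(ρ * M * H).trace - star (ρ * M * H).trace‖ := by
        rw [hrate, norm_mul, norm_neg, Complex.norm_I, one_mul]
    _ ≤ ‖(ρ * M * H).trace‖ + ‖star (ρ * M * H).trace‖ := norm_sub_le _ _
    _ ≤ opNorm d n H * (2 * Real.logb 2 D) + opNorm d n H * (2 * Real.logb 2 D) := by
      rw [norm_star]
      exact add_le_add hbound hbound
    _ = 4 * opNorm d n H * k * Real.logb 2 d := by
      rw [hlog]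
      ring

end QC
end
end

section
/- Let n ≥ 1, let γ_1,…,γ_{2n} be Hermitian operators on (ℂ²)^{⊗n} satisfying the Clifford-algebra relations, and let O be a linear operator on (ℂ²)^{⊗n} with ‖O‖₂ = 1. Then the Fourier entropy of O with respect to the Clifford basis satisfies H^G[O] ≤ 2·log(2n)·I^G[O] + h(P^G_O[∅]), where H^G[O] = −Σ_{S⊆{1,…,2n}} P^G_O[S]·log P^G_O[S] (with 0·log 0 = 0). -/
open Matrix Complex BigOperators
open scoped ComplexOrder
noncomputable section

namespace QC

/-- The sign picked up when a Majorana generator `γ_i` is moved past `γ^S`. -/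
def gammaSign {n : ℕ} (S : Finset (Fin (2 * n))) (i : Fin (2 * n)) : ℂ :=
  (-1) ^ (S.erase i).card

theorem gammaSign_mul_self {n : ℕ} (S : Finset (Fin (2 * n))) (i : Fin (2 * n)) :
    gammaSign S i * gammaSign S i = 1 := by
  rw [gammaSign, ← mul_pow]
  norm_num

section Clifford

variable {n : ℕ} {γ : Fin (2 * n) → QOp 2 n}

theorem gamma_mul_self
    (hcar : ∀ i j, γ i * γ j + γ j * γ i = if i = j then (2 : ℂ) • (1 : QOp 2 n) else 0)
    (i : Fin (2 * n)) : γ i * γ i = 1 := by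
  have h := hcar i i
  rw [if_pos rfl, ← two_smul ℂ (γ i * γ i)] at h
  exact smul_right_injective _ (two_ne_zero (α := ℂ)) h

theorem gamma_mul_list_prod
    (hcar : ∀ i j, γ i * γ j + γ j * γ i = if i = j then (2 : ℂ) • (1 : QOp 2 n) else 0)
    (i : Fin (2 * n)) (L : List (Fin (2 * n))) :
    γ i * (L.map γ).prod =
      (L.map fun j => if j = i then (1 : ℂ) else -1).prod • ((L.map γ).prod * γ i) := by
  induction L with
  | nil => simp
  | cons j L ih =>
    have hswap : γ i * γ j = (if j = i then (1 : ℂ) else -1) • (γ j * γ i) := by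
      by_cases hji : j = i
      · simp [hji]
      · have h := hcar i j
        rw [if_neg (Ne.symm hji)] at h
        simpa [hji] using eq_neg_of_add_eq_zero_left h
    simp only [List.map_cons, List.prod_cons]
    rw [← mul_assoc, hswap, smul_mul_assoc, mul_assoc, ih, mul_smul_comm, smul_smul, mul_assoc]

theorem gamma_mul_gammaProd
    (hcar : ∀ i j, γ i * γ j + γ j * γ i = if i = j then (2 : ℂ) • (1 : QOp 2 n) else 0)
    (i : Fin (2 * n)) (S : Finset (Fin (2 * n))) :
    γ i * gammaProd n γ S = gammaSign S i • (gammaProd n γ S * γ i) := by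
  have hsign : ((S.sort (· ≤ ·)).map fun j => if j = i then (1 : ℂ) else -1).prod =
      gammaSign S i := by
    rw [← List.prod_toFinset _ (S.sort_nodup (· ≤ ·)), Finset.sort_toFinset,
      Finset.prod_ite, Finset.prod_const_one, one_mul, Finset.prod_const, gammaSign,
      Finset.filter_ne']
  rw [gammaProd, gamma_mul_list_prod hcar, hsign]

theorem gammaProd_conjTranspose_mul_self (hherm : ∀ i, (γ i).IsHermitian)
    (hcar : ∀ i j, γ i * γ j + γ j * γ i = if i = j then (2 : ℂ) • (1 : QOp 2 n) else 0)
    (S : Finset (Fin (2 * n))) : (gammaProd n γ S)ᴴ * gammaProd n γ S = 1 := by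
  unfold gammaProd
  induction S.sort (· ≤ ·) with
  | nil => simp
  | cons j L ih =>
    rw [List.map_cons, List.prod_cons, conjTranspose_mul, (hherm j).eq, mul_assoc,
      ← mul_assoc (γ j), gamma_mul_self hcar, one_mul, ih]

/-- Two subsets of a set of even size that give the same commutation signs are equal. -/
theorem eq_of_gammaSign_eq {S T : Finset (Fin (2 * n))}
    (h : ∀ i, gammaSign S i = gammaSign T i) : S = T := by
  have hparity : ∀ i, (Even (S.erase i).card ↔ Even (T.erase i).card) := by
    intro i
    have hi := h i
    unfold gammaSign at hi
    rw [← neg_one_pow_eq_one_iff_even (R := ℂ) (by norm_num), hi,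
      neg_one_pow_eq_one_iff_even (by norm_num)]
  have herase : ∀ (U : Finset (Fin (2 * n))) (i : Fin (2 * n)),
      (Even (U.erase i).card ↔ (Even U.card ↔ i ∉ U)) := by
    intro U i
    by_cases hi : i ∈ U
    · have := Finset.card_erase_add_one hi
      rw [← this, Nat.even_add_one]
      simp [hi]
    · simp [hi]
  simp only [herase] at hparity
  by_cases hST : Even S.card ↔ Even T.card
  · ext i
    have := hparity i
    tauto
  · have hcompl : T = Sᶜ := by
      ext i
      have := hparity i
      rw [Finset.mem_compl]
      tauto
    have hcard := S.card_add_card_compl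
    rw [← hcompl, Fintype.card_fin] at hcard
    exact absurd (Nat.even_add.mp (by rw [hcard]; exact even_two_mul n)) hST

theorem trace_gammaProd_conjTranspose_mul_of_ne (hherm : ∀ i, (γ i).IsHermitian)
    (hcar : ∀ i j, γ i * γ j + γ j * γ i = if i = j then (2 : ℂ) • (1 : QOp 2 n) else 0)
    {S T : Finset (Fin (2 * n))} (hST : S ≠ T) :
    ((gammaProd n γ S)ᴴ * gammaProd n γ T).trace = 0 := by
  by_contra hne
  refine hST (eq_of_gammaSign_eq fun i => ?_)
  have hS : (gammaProd n γ S)ᴴ * γ i = gammaSign S i • (γ i * (gammaProd n γ S)ᴴ) := by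
    have := congrArg conjTranspose (gamma_mul_gammaProd hcar i S)
    simpa [conjTranspose_mul, conjTranspose_smul, (hherm i).eq, gammaSign] using this
  have htr : ((gammaProd n γ S)ᴴ * gammaProd n γ T).trace =
      gammaSign S i * (gammaSign T i * ((gammaProd n γ S)ᴴ * gammaProd n γ T).trace) := by
    calc ((gammaProd n γ S)ᴴ * gammaProd n γ T).trace
        = ((gammaProd n γ S)ᴴ * γ i * (γ i * gammaProd n γ T)).trace := by
          rw [mul_assoc, ← mul_assoc (γ i), gamma_mul_self hcar, one_mul]
      _ = gammaSign S i * (gammaSign T i *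
            (γ i * ((gammaProd n γ S)ᴴ * gammaProd n γ T) * γ i).trace) := by
          rw [hS, gamma_mul_gammaProd hcar, smul_mul_smul_comm, trace_smul, smul_eq_mul,
            mul_assoc (gammaSign S i)]
          simp only [mul_assoc]
      _ = _ := by
          rw [trace_mul_comm, ← mul_assoc (γ i), gamma_mul_self hcar, one_mul]
  have hprod : gammaSign S i * gammaSign T i = 1 := by
    rw [← mul_assoc] at htr
    exact (mul_eq_right₀ hne).mp htr.symm
  calc gammaSign S i = gammaSign S i * (gammaSign T i * gammaSign T i) := by
        rw [gammaSign_mul_self, mul_one]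
    _ = gammaSign T i := by rw [← mul_assoc, hprod, one_mul]

end Clifford

/-- An operator seen as a vector of the Hilbert–Schmidt space. -/
def hsVec {n : ℕ} (A : QOp 2 n) : EuclideanSpace ℂ ((Fin n → Fin 2) × (Fin n → Fin 2)) :=
  WithLp.toLp 2 fun p => A p.1 p.2

theorem inner_hsVec {n : ℕ} (A B : QOp 2 n) : inner ℂ (hsVec A) (hsVec B) = (Aᴴ * B).trace := by
  simp only [hsVec, PiLp.inner_apply, RCLike.inner_apply, trace, diag_apply, mul_apply,
    conjTranspose_apply, Fintype.sum_prod_type]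
  rw [Finset.sum_comm]
  simp only [mul_comm, RCLike.star_def]

/-- Parseval's identity for the Clifford basis. -/
theorem sum_pdistG (n : ℕ) (γ : Fin (2 * n) → QOp 2 n) (hherm : ∀ i, (γ i).IsHermitian)
    (hcar : ∀ i j, γ i * γ j + γ j * γ i = if i = j then (2 : ℂ) • (1 : QOp 2 n) else 0)
    (O : QOp 2 n) : ∑ S, pdistG n γ O S = l2norm 2 n O ^ 2 := by
  set c : ℝ := (Real.sqrt (2 ^ n))⁻¹ with hc
  have hc2 : c ^ 2 = (2 ^ n)⁻¹ := by rw [hc, inv_pow, Real.sq_sqrt (by positivity)]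
  have hinner : ∀ S T, inner ℂ ((c : ℂ) • hsVec (gammaProd n γ S))
      ((c : ℂ) • hsVec (gammaProd n γ T)) =
        (c : ℂ) ^ 2 * ((gammaProd n γ S)ᴴ * gammaProd n γ T).trace := by
    intro S T
    rw [inner_smul_left, inner_smul_right, inner_hsVec, Complex.conj_ofReal]
    ring
  have hon : Orthonormal ℂ fun S => (c : ℂ) • hsVec (gammaProd n γ S) := by
    rw [orthonormal_iff_ite]
    intro S T
    rw [hinner]
    split_ifs with h
    · subst h
      rw [gammaProd_conjTranspose_mul_self hherm hcar, trace_one, ← Complex.ofReal_pow, hc2]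
      simp
    · rw [trace_gammaProd_conjTranspose_mul_of_ne hherm hcar h, mul_zero]
  have hcard : Fintype.card (Finset (Fin (2 * n))) =
      Module.finrank ℂ (EuclideanSpace ℂ ((Fin n → Fin 2) × (Fin n → Fin 2))) := by
    simp [← pow_add, two_mul]
  let b := (basisOfOrthonormalOfCardEqFinrank hon hcard).toOrthonormalBasis
    (by rwa [coe_basisOfOrthonormalOfCardEqFinrank])
  have hb : ∀ S, b S = (c : ℂ) • hsVec (gammaProd n γ S) := fun S => by simp [b]
  have hparseval := b.sum_sq_norm_inner_right (hsVec O)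
  have hnorm : ‖hsVec O‖ ^ 2 = ((Oᴴ * O).trace).re := by
    rw [← inner_hsVec, ← inner_self_eq_norm_sq (𝕜 := ℂ)]
    rfl
  have hpdist : ∀ S, pdistG n γ O S = (2 ^ n)⁻¹ * ‖inner ℂ (b S) (hsVec O)‖ ^ 2 := by
    intro S
    rw [hb, inner_smul_left, inner_hsVec, Complex.conj_ofReal, norm_mul, mul_pow,
      Complex.norm_real, Real.norm_eq_abs, sq_abs, hc2, pdistG, two_mul, pow_add]
    field_simp
  simp only [hpdist]
  rw [← Finset.mul_sum, hparseval, hnorm, l2norm, Real.sq_sqrt]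
  · push_cast
    ring
  · rw [← hnorm]
    positivity

/-- Gibbs' inequality relative to a distinguished outcome `a₀` and a sub-probability vector `r`
on the remaining outcomes. -/
theorem entropy_le_binEntropy_add_sum {α : Type*} [Fintype α] [DecidableEq α] (p r : α → ℝ)
    (a₀ : α) (hp : ∀ a, 0 ≤ p a) (hsum : ∑ a, p a = 1) (hr : ∀ a, 0 < r a)
    (hrsum : ∑ a ∈ Finset.univ.erase a₀, r a ≤ 1) :
    -∑ a, p a * Real.logb 2 (p a) ≤
      binEntropy (p a₀) - ∑ a ∈ Finset.univ.erase a₀, p a * Real.logb 2 (r a) := by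
  have hlog2 : 0 < Real.log 2 := Real.log_pos one_lt_two
  have hq : ∑ a ∈ Finset.univ.erase a₀, p a = 1 - p a₀ := by
    rw [← hsum, ← Finset.add_sum_erase _ p (Finset.mem_univ a₀)]
    ring
  have hq0 : 0 ≤ 1 - p a₀ := hq ▸ Finset.sum_nonneg fun a _ => hp a
  have hterm : ∀ a ∈ Finset.univ.erase a₀, -(p a * Real.log (p a)) ≤
      -(p a * Real.log (r a)) - p a * Real.log (1 - p a₀) + ((1 - p a₀) * r a - p a) := by
    intro a ha
    rcases (hp a).eq_or_lt with h0 | h0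
    · rw [← h0]
      simpa using mul_nonneg hq0 (hr a).le
    · have hqpos : 0 < 1 - p a₀ :=
        h0.trans_le (hq ▸ Finset.single_le_sum (fun a _ => hp a) ha)
      have hle := Real.log_le_sub_one_of_pos (div_pos (mul_pos hqpos (hr a)) h0)
      rw [Real.log_div (mul_pos hqpos (hr a)).ne' h0.ne',
        Real.log_mul hqpos.ne' (hr a).ne'] at hle
      have hmul := mul_le_mul_of_nonneg_left hle h0.le
      have : p a * ((1 - p a₀) * r a / p a - 1) = (1 - p a₀) * r a - p a := by
        field_simp
      linarith
  have hmain := Finset.sum_le_sum hterm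
  rw [Finset.sum_add_distrib, Finset.sum_sub_distrib, Finset.sum_sub_distrib,
    Finset.sum_neg_distrib, Finset.sum_neg_distrib, ← Finset.sum_mul, ← Finset.mul_sum, hq]
    at hmain
  have hslack : (1 - p a₀) * ∑ a ∈ Finset.univ.erase a₀, r a ≤ 1 - p a₀ :=
    mul_le_of_le_one_right hq0 hrsum
  simp only [binEntropy, Real.logb, ← mul_div_assoc, ← Finset.sum_div]
  rw [← neg_div, ← neg_div, ← sub_div, ← sub_div, div_le_div_iff_of_pos_right hlog2,
    ← Finset.add_sum_erase _ (fun a => p a * Real.log (p a)) (Finset.mem_univ a₀)]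
  linarith

theorem sum_erase_empty_inv_sq_pow_card_le_one (m : ℕ) (hm : 2 ≤ m) :
    ∑ S ∈ (Finset.univ : Finset (Finset (Fin m))).erase ∅, (((m : ℝ) ^ 2)⁻¹) ^ S.card ≤ 1 := by
  have hm' : (2 : ℝ) ≤ m := by exact_mod_cast hm
  have htotal : ∑ S : Finset (Fin m), (((m : ℝ) ^ 2)⁻¹) ^ S.card = (((m : ℝ) ^ 2)⁻¹ + 1) ^ m := by
    simpa using Finset.sum_pow_mul_eq_add_pow (((m : ℝ) ^ 2)⁻¹) 1 (Finset.univ : Finset (Fin m))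
  have hexp : (((m : ℝ) ^ 2)⁻¹ + 1) ^ m ≤ Real.exp (1 / m) := by
    calc (((m : ℝ) ^ 2)⁻¹ + 1) ^ m ≤ Real.exp (((m : ℝ) ^ 2)⁻¹) ^ m := by
          gcongr
          exact Real.add_one_le_exp _
      _ = Real.exp (1 / m) := by
          rw [← Real.exp_nat_mul]
          congr 1
          field_simp
  have hhalf : (1 : ℝ) / m ≤ 1 / 2 := by gcongr
  have hinv : Real.exp (1 / m) * Real.exp (-(1 / m)) = 1 := by rw [← Real.exp_add]; simp
  have htwo : Real.exp (1 / m) ≤ 2 := by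
    nlinarith [Real.one_sub_le_exp_neg (1 / (m : ℝ)), Real.exp_pos (1 / (m : ℝ))]
  rw [← Finset.add_sum_erase _ _ (Finset.mem_univ (∅ : Finset (Fin m)))] at htotal
  simp only [Finset.card_empty, pow_zero] at htotal
  linarith

/-- **Weak quantum Fourier entropy–Gaussian influence relation**:
`H^G[O] ≤ 2 log(2n) I^G[O] + h(P^G_O[∅])`. -/
theorem gaussian_entropy_influence (n : ℕ) (hn : 1 ≤ n)
    (γ : Fin (2 * n) → QOp 2 n) (hherm : ∀ i, (γ i).IsHermitian)
    (hcar : ∀ i j, γ i * γ j + γ j * γ i = if i = j then (2 : ℂ) • (1 : QOp 2 n) else 0)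
    (O : QOp 2 n) (hO : l2norm 2 n O = 1) :
    entropyG n γ O ≤ 2 * Real.logb 2 (2 * n) * influenceG n γ O
      + binEntropy (pdistG n γ O ∅) := by
  have hp : ∀ S, 0 ≤ pdistG n γ O S := fun S => by
    unfold pdistG
    positivity
  have hsum : ∑ S, pdistG n γ O S = 1 := by rw [sum_pdistG n γ hherm hcar, hO, one_pow]
  have hlog : ∀ S : Finset (Fin (2 * n)),
      Real.logb 2 (((((2 * n : ℕ) : ℝ) ^ 2)⁻¹) ^ S.card) =
        -(2 * Real.logb 2 (2 * n) * S.card) := by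
    intro S
    rw [Real.logb_pow, Real.logb_inv, Real.logb_pow]
    push_cast
    ring
  have hinfl : influenceG n γ O =
      ∑ S ∈ Finset.univ.erase ∅, (S.card : ℝ) * pdistG n γ O S := by
    rw [influenceG, ← Finset.add_sum_erase _ _ (Finset.mem_univ ∅)]
    simp
  have hgibbs := entropy_le_binEntropy_add_sum (pdistG n γ O)
    (fun S => ((((2 * n : ℕ) : ℝ) ^ 2)⁻¹) ^ S.card) ∅ hp hsum (fun S => by positivity)
    (sum_erase_empty_inv_sq_pow_card_le_one (2 * n) (by omega))
  have hweight : ∑ S ∈ Finset.univ.erase ∅,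
      pdistG n γ O S * Real.logb 2 (((((2 * n : ℕ) : ℝ) ^ 2)⁻¹) ^ S.card) =
        -(2 * Real.logb 2 (2 * n) * influenceG n γ O) := by
    rw [hinfl, Finset.mul_sum, ← Finset.sum_neg_distrib]
    refine Finset.sum_congr rfl fun S _ => ?_
    rw [hlog]
    ring
  rw [hweight] at hgibbs
  rw [entropyG]
  linarith

end QC
end
end
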